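/- arXiv:0906.1856 — 2 statements merged into one kernel-verified Lean document; each statement's English description precedes it below -/
import Mathlib

section
/- Fix 0 ≤ s < t < ∞ and y ≥ 0. Then the mean and variance of H_{s,t}(y,·) are given by ∫_{[0,∞)} x H_{s,t}(y,dx) = y·B(s,t) and ∫_{[0,∞)} (x − y·B(s,t))² H_{s,t}(y,dx) = y·2·B(s,t)/p(s,t). -/
open MeasureTheory Filter Set

/-- `C(s,t) = ∫_s^t (σ²(v)/2)·exp(∫_0^v β(u)du) dv` -/
noncomputable def Cf (σ β : ℝ → ℝ) (s t : ℝ) : ℝ :=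
  ∫ v in s..t, σ v ^ 2 / 2 * Real.exp (∫ u in (0:ℝ)..v, β u)

/-- `B(s,t) = exp(−∫_s^t β(v)dv)` -/
noncomputable def Bf (β : ℝ → ℝ) (s t : ℝ) : ℝ :=
  Real.exp (-∫ v in s..t, β v)

/-- `p(s,t) = 1/(B(0,t)·C(s,t))` -/
noncomputable def pf (σ β : ℝ → ℝ) (s t : ℝ) : ℝ :=
  1 / (Bf β 0 t * Cf σ β s t)

/-- `γ(s,t) = 1/(B(0,s)·C(s,t))` -/
noncomputable def gf (σ β : ℝ → ℝ) (s t : ℝ) : ℝ :=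
  1 / (Bf β 0 s * Cf σ β s t)

open ProbabilityTheory in
/-- The Poisson(θ)-mixture of Gamma laws: weight `e^{−θ}` on the Dirac measure at `0` and
weight `e^{−θ}θ^m/m!` on the Gamma law `Γ(m,p)` for `m ≥ 1`. -/
noncomputable def poissonGammaMix (θ p : ℝ) : Measure ℝ :=
  ENNReal.ofReal (Real.exp (-θ)) • Measure.dirac 0 +
  Measure.sum (fun m : ℕ =>
    ENNReal.ofReal (Real.exp (-θ) * θ ^ (m + 1) / (Nat.factorial (m + 1))) •
      gammaMeasure ((m : ℝ) + 1) p)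

/-- `H_{s,t}(y,·) = e^{−y·γ(s,t)}·δ₀ + Σ_{m≥1} (e^{−y·γ(s,t)}(y·γ(s,t))^m/m!)·Γ(m,p(s,t))`. -/
noncomputable def Hm (σ β : ℝ → ℝ) (s t y : ℝ) : Measure ℝ :=
  poissonGammaMix (y * gf σ β s t) (pf σ β s t)
open ProbabilityTheory in
theorem integrable_and_integral_pow_gammaMeasure {a r : ℝ} (ha : 0 < a) (hr : 0 < r) (k : ℕ) :
    Integrable (fun x ↦ x ^ k) (gammaMeasure a r) ∧
      ∫ x, x ^ k ∂gammaMeasure a r = Real.Gamma (a + k) / (Real.Gamma a * r ^ k) := by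
  have hak : 0 < a + k := by positivity
  have hmeas : Measurable (gammaPDF a r) := (measurable_gammaPDFReal a r).ennreal_ofReal
  have hlt : ∀ᵐ x, gammaPDF a r x < ⊤ := ae_of_all _ fun _ ↦ ENNReal.ofReal_lt_top
  have hae : (fun x ↦ (gammaPDF a r x).toReal • x ^ k) =ᵐ[volume]
      (Ioi 0).indicator fun x ↦
        r ^ a / Real.Gamma a * (x ^ (a + k - 1) * Real.exp (-(r * x))) := by
    filter_upwards [Measure.ae_ne volume (0 : ℝ)] with x hx
    rw [gammaPDF, ENNReal.toReal_ofReal (gammaPDFReal_nonneg ha hr x), gammaPDFReal]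
    rcases lt_or_gt_of_ne hx with h | h
    · rw [if_neg h.not_ge, indicator_of_notMem (by simpa using h.le), zero_smul]
    · rw [if_pos h.le, indicator_of_mem (by simpa using h), smul_eq_mul,
        show a + k - 1 = a - 1 + k by ring, Real.rpow_add h, Real.rpow_natCast]
      ring
  have hint := Real.integral_rpow_mul_exp_neg_mul_Ioi hak hr
  have hpos : 0 < (1 / r) ^ (a + k) * Real.Gamma (a + k) :=
    mul_pos (by positivity) (Real.Gamma_pos_of_pos hak)
  have hI : IntegrableOn (fun x ↦ x ^ (a + k - 1) * Real.exp (-(r * x))) (Ioi 0) := by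
    by_contra h
    rw [integral_undef h] at hint
    exact hpos.ne hint
  constructor
  · rw [gammaMeasure, integrable_withDensity_iff_integrable_smul' hmeas hlt, integrable_congr hae,
      integrable_indicator_iff measurableSet_Ioi]
    exact hI.const_mul _
  · rw [gammaMeasure, integral_withDensity_eq_integral_toReal_smul hmeas hlt,
      integral_congr_ae hae, integral_indicator measurableSet_Ioi, integral_const_mul, hint,
      Real.div_rpow zero_le_one hr.le, Real.one_rpow, Real.rpow_add hr, Real.rpow_natCast]
    have := (Real.Gamma_pos_of_pos ha).ne'
    have := (Real.rpow_pos_of_pos hr a).ne'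
    field_simp

open ProbabilityTheory in
theorem integrable_and_integral_pow_poissonGammaMix {θ p : ℝ} (hθ : 0 ≤ θ) (hp : 0 < p) (k : ℕ)
    {S : ℝ}
    (hS : HasSum (fun m : ℕ ↦ θ ^ (m + 1) / (Nat.factorial (m + 1)) *
      (Real.Gamma (m + 1 + k) / Real.Gamma (m + 1))) S) :
    Integrable (fun x ↦ x ^ k) (poissonGammaMix θ p) ∧
      ∫ x, x ^ k ∂poissonGammaMix θ p = Real.exp (-θ) * (0 ^ k + S / p ^ k) := by
  have hw (m : ℕ) : 0 ≤ Real.exp (-θ) * θ ^ (m + 1) / (Nat.factorial (m + 1)) := by positivity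
  have hg (m : ℕ) := integrable_and_integral_pow_gammaMeasure
    (show (0 : ℝ) < (m : ℝ) + 1 by positivity) hp k
  have hval (m : ℕ) : ∫ x, x ^ k ∂(ENNReal.ofReal
        (Real.exp (-θ) * θ ^ (m + 1) / (Nat.factorial (m + 1))) • gammaMeasure ((m : ℝ) + 1) p) =
      Real.exp (-θ) / p ^ k * (θ ^ (m + 1) / (Nat.factorial (m + 1)) *
        (Real.Gamma (m + 1 + k) / Real.Gamma (m + 1))) := by
    rw [integral_smul_measure, (hg m).2, ENNReal.toReal_ofReal (hw m), smul_eq_mul]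
    have := (Real.Gamma_pos_of_pos (show (0 : ℝ) < (m : ℝ) + 1 by positivity)).ne'
    field_simp
  have hnorm (m : ℕ) : ∫ x, ‖x ^ k‖ ∂(ENNReal.ofReal
        (Real.exp (-θ) * θ ^ (m + 1) / (Nat.factorial (m + 1))) • gammaMeasure ((m : ℝ) + 1) p) =
      ∫ x, x ^ k ∂(ENNReal.ofReal
        (Real.exp (-θ) * θ ^ (m + 1) / (Nat.factorial (m + 1))) •
          gammaMeasure ((m : ℝ) + 1) p) := by
    refine integral_congr_ae (Measure.ae_smul_measure ?_ _)
    rw [gammaMeasure]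
    have hmeas : Measurable (gammaPDF ((m : ℝ) + 1) p) :=
      (measurable_gammaPDFReal _ p).ennreal_ofReal
    refine (ae_withDensity_iff hmeas).2 (ae_of_all _ fun x hx ↦ ?_)
    have hx0 : 0 ≤ x := by
      by_contra h
      exact hx (gammaPDF_of_neg (not_le.1 h))
    exact Real.norm_of_nonneg (pow_nonneg hx0 k)
  have hsum := hS.mul_left (Real.exp (-θ) / p ^ k)
  have hI := integrable_sum_measure
    (fun m : ℕ ↦ (hg m).1.smul_measure (ENNReal.ofReal_ne_top
      (r := Real.exp (-θ) * θ ^ (m + 1) / (Nat.factorial (m + 1)))))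
    (by simp_rw [hnorm, hval]; exact hsum.summable)
  have hD : Integrable (fun x : ℝ ↦ x ^ k)
      (ENNReal.ofReal (Real.exp (-θ)) • Measure.dirac (0 : ℝ)) :=
    (integrable_dirac (by simp)).smul_measure ENNReal.ofReal_ne_top
  refine ⟨hD.add_measure hI, ?_⟩
  have h := hasSum_integral_measure hI
  simp_rw [hval] at h
  rw [poissonGammaMix, integral_add_measure hD hI, h.unique hsum, integral_smul_measure,
    integral_dirac, ENNReal.toReal_ofReal (Real.exp_pos _).le, smul_eq_mul]
  ring

theorem Real.hasSum_pow_div_factorial (θ : ℝ) :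
    HasSum (fun m : ℕ ↦ θ ^ m / (Nat.factorial m)) (Real.exp θ) := by
  rw [Real.exp_eq_exp_ℝ]
  exact NormedSpace.expSeries_div_hasSum_exp θ

theorem Real.hasSum_pow_succ_div_factorial_succ (θ : ℝ) :
    HasSum (fun m : ℕ ↦ θ ^ (m + 1) / (Nat.factorial (m + 1))) (Real.exp θ - 1) := by
  simpa using (hasSum_nat_add_iff' 1).2 (Real.hasSum_pow_div_factorial θ)

theorem Real.hasSum_natCast_mul_pow_div_factorial (θ : ℝ) :
    HasSum (fun m : ℕ ↦ m * (θ ^ m / (Nat.factorial m))) (θ * Real.exp θ) := by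
  rw [← hasSum_nat_add_iff' 1]
  convert! (Real.hasSum_pow_div_factorial θ).mul_left θ using 1
  · ext m
    rw [Nat.factorial_succ]
    push_cast
    field_simp
    ring
  · simp

section PoissonGammaMix

variable {θ p : ℝ}

theorem isProbabilityMeasure_poissonGammaMix (hθ : 0 ≤ θ) (hp : 0 < p) :
    IsProbabilityMeasure (poissonGammaMix θ p) := by
  have h := integrable_and_integral_pow_poissonGammaMix hθ hp 0 (S := Real.exp θ - 1) (by
    convert! Real.hasSum_pow_succ_div_factorial_succ θ using 1
    ext m
    have := (Real.Gamma_pos_of_pos (show (0 : ℝ) < (m : ℝ) + 1 by positivity)).ne'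
    simp [this])
  have h1 := h.2
  simp only [pow_zero, integral_const, smul_eq_mul, mul_one, div_one, add_sub_cancel,
    ← Real.exp_add, neg_add_cancel, Real.exp_zero] at h1
  exact isProbabilityMeasure_iff_real.2 h1

theorem integrable_id_and_integral_id_poissonGammaMix (hθ : 0 ≤ θ) (hp : 0 < p) :
    Integrable (fun x ↦ x) (poissonGammaMix θ p) ∧
      ∫ x, x ∂poissonGammaMix θ p = θ / p := by
  have h := integrable_and_integral_pow_poissonGammaMix hθ hp 1 (S := θ * Real.exp θ) (by
    convert! (Real.hasSum_pow_div_factorial θ).mul_left θ using 1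
    ext m
    have hm : (0 : ℝ) < (m : ℝ) + 1 := by positivity
    have := (Real.Gamma_pos_of_pos hm).ne'
    rw [Nat.cast_one, Real.Gamma_add_one hm.ne', Nat.factorial_succ]
    push_cast
    field_simp
    ring)
  simp only [pow_one] at h
  refine ⟨h.1, h.2.trans ?_⟩
  rw [Real.exp_neg]
  field_simp
  ring

theorem integrable_sq_and_integral_sq_poissonGammaMix (hθ : 0 ≤ θ) (hp : 0 < p) :
    Integrable (fun x ↦ x ^ 2) (poissonGammaMix θ p) ∧
      ∫ x, x ^ 2 ∂poissonGammaMix θ p = (θ ^ 2 + 2 * θ) / p ^ 2 := by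
  have h := integrable_and_integral_pow_poissonGammaMix hθ hp 2
    (S := θ * (θ * Real.exp θ + 2 * Real.exp θ)) (by
    convert! ((Real.hasSum_natCast_mul_pow_div_factorial θ).add
      ((Real.hasSum_pow_div_factorial θ).mul_left 2)).mul_left θ using 1
    ext m
    have hm : (0 : ℝ) < (m : ℝ) + 1 := by positivity
    have := (Real.Gamma_pos_of_pos hm).ne'
    rw [show (m : ℝ) + 1 + (2 : ℕ) = (m : ℝ) + 1 + 1 + 1 by push_cast; ring,
      Real.Gamma_add_one (by positivity), Real.Gamma_add_one hm.ne', Nat.factorial_succ]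
    push_cast
    field_simp
    ring)
  refine ⟨h.1, h.2.trans ?_⟩
  rw [Real.exp_neg]
  field_simp
  ring

theorem integral_sub_sq_poissonGammaMix (hθ : 0 ≤ θ) (hp : 0 < p) :
    ∫ x, (x - θ / p) ^ 2 ∂poissonGammaMix θ p = 2 * θ / p ^ 2 := by
  have := isProbabilityMeasure_poissonGammaMix hθ hp
  obtain ⟨i1, e1⟩ := integrable_id_and_integral_id_poissonGammaMix hθ hp
  obtain ⟨i2, e2⟩ := integrable_sq_and_integral_sq_poissonGammaMix hθ hp
  calc ∫ x, (x - θ / p) ^ 2 ∂poissonGammaMix θ p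
      = ∫ x, (x ^ 2 - 2 * (θ / p) * x + (θ / p) ^ 2) ∂poissonGammaMix θ p := by
        congr 1 with x
        ring
    _ = 2 * θ / p ^ 2 := by
        have i3 : Integrable (fun x ↦ x ^ 2 - 2 * (θ / p) * x) (poissonGammaMix θ p) :=
          i2.sub (i1.const_mul _)
        rw [integral_add i3 (integrable_const _), integral_sub i2 (i1.const_mul _), integral_const_mul, e1, e2]
        simp
        field_simp
        ring

end PoissonGammaMix

theorem Cf_pos {σ β : ℝ → ℝ} {s t : ℝ} (hσc : ContinuousOn σ (Set.Ici 0))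
    (hβc : ContinuousOn β (Set.Ici 0)) (hσpos : ∀ x ∈ Set.Ici (0 : ℝ), 0 < σ x)
    (hs : 0 ≤ s) (hst : s < t) : 0 < Cf σ β s t := by
  have h0t : (0 : ℝ) ≤ t := hs.trans hst.le
  have hsub : Icc s t ⊆ Ici 0 := fun x hx ↦ hs.trans hx.1
  have hprim : ContinuousOn (fun v ↦ ∫ u in (0 : ℝ)..v, β u) (Icc s t) := by
    have h := intervalIntegral.continuousOn_primitive_interval (μ := volume) (f := β) (a := 0)
      (b := t) ((hβc.mono (by rw [uIcc_of_le h0t]; exact Icc_subset_Ici_self)).integrableOn_compact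
        isCompact_uIcc)
    rw [uIcc_of_le h0t] at h
    exact h.mono (Icc_subset_Icc_left hs)
  refine intervalIntegral.intervalIntegral_pos_of_pos_on
    (ContinuousOn.intervalIntegrable ?_) (fun v hv ↦ ?_) hst
  · rw [uIcc_of_le hst.le]
    exact (((hσc.mono hsub).pow 2).div_const 2).mul hprim.rexp
  · have := hσpos v (hsub (Ioo_subset_Icc_self hv))
    positivity

theorem Bf_mul_Bf {β : ℝ → ℝ} {s t : ℝ} (hβc : ContinuousOn β (Set.Ici 0))
    (hs : 0 ≤ s) (ht : 0 ≤ t) : Bf β 0 s * Bf β s t = Bf β 0 t := by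
  have hi : ∀ a b, 0 ≤ a → 0 ≤ b → IntervalIntegrable β volume a b := fun a b ha hb ↦
    (hβc.mono fun x hx ↦ (le_min ha hb).trans hx.1).intervalIntegrable
  rw [Bf, Bf, Bf, ← Real.exp_add,
    ← intervalIntegral.integral_add_adjacent_intervals (hi 0 s le_rfl hs) (hi s t hs ht), neg_add]

/-- Mean and variance of `H_{s,t}(y,·)`:
`∫ x H_{s,t}(y,dx) = y·B(s,t)` and `∫ (x−y·B(s,t))² H_{s,t}(y,dx) = y·2·B(s,t)/p(s,t)`. -/
theorem stmt_10 (σ β : ℝ → ℝ)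
    (hσc : ContinuousOn σ (Set.Ici 0)) (hβc : ContinuousOn β (Set.Ici 0))
    (hσpos : ∀ x ∈ Set.Ici (0:ℝ), 0 < σ x) (hβnn : ∀ x ∈ Set.Ici (0:ℝ), 0 ≤ β x)
    (s t y : ℝ) (hs : 0 ≤ s) (hst : s < t) (hy : 0 ≤ y) :
    (∫ x, x ∂(Hm σ β s t y)) = y * Bf β s t ∧
    (∫ x, (x - y * Bf β s t) ^ 2 ∂(Hm σ β s t y)) = y * (2 * Bf β s t / pf σ β s t) := by
  have hC := Cf_pos hσc hβc hσpos hs hst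
  have hBs : 0 < Bf β 0 s := Real.exp_pos _
  have hBt : 0 < Bf β 0 t := Real.exp_pos _
  have hp : 0 < pf σ β s t := by rw [pf]; positivity
  have hθ : 0 ≤ y * gf σ β s t := by rw [gf]; positivity
  have hmean : y * Bf β s t = y * gf σ β s t / pf σ β s t := by
    rw [gf, pf, ← Bf_mul_Bf hβc hs (hs.trans hst.le)]
    field_simp
  have hvar : y * (2 * Bf β s t / pf σ β s t) = 2 * (y * gf σ β s t) / pf σ β s t ^ 2 := by
    rw [show y * (2 * Bf β s t / pf σ β s t) = 2 * (y * Bf β s t) / pf σ β s t by ring, hmean]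
    field_simp
  rw [hvar, hmean]
  exact ⟨(integrable_id_and_integral_id_poissonGammaMix hθ hp).2,
    integral_sub_sq_poissonGammaMix hθ hp⟩
end

section
/- Let ν be a σ-finite measure on (0,∞) with ∫ (√y ∧ 1) ν(dy) < ∞, let ã : [0,∞) → ℝ be nonnegative, right-continuous and bounded, and fix 0 ≤ t₁ < t₂ < t₃ < ∞. Suppose μ₁₂, μ₂₃ and μ₁₃ are probability measures on [0,∞) whose Laplace transforms are λ ↦ exp(−∫_{t₁}^{t₂} ã(v)Ψ̃_{v,t₂}(λ)dv), λ ↦ exp(−∫_{t₂}^{t₃} ã(v)Ψ̃_{v,t₃}(λ)dv) and λ ↦ exp(−∫_{t₁}^{t₃} ã(v)Ψ̃_{v,t₃}(λ)dv) respectively. Then the skew convolution property (μ₁₂ H_{t₂,t₃}) ∗ μ₂₃ = μ₁₃ holds, where μH_{s,t} denotes the measure A ↦ ∫_{[0,∞)} H_{s,t}(y,A) μ(dy) and ∗ denotes convolution of measures on [0,∞). -/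
open MeasureTheory Filter Set

/-- `Ψ_{s,t}(λ) = γ(s,t)·λ/(p(s,t)+λ)` -/
noncomputable def Psi (σ β : ℝ → ℝ) (s t l : ℝ) : ℝ :=
  gf σ β s t * l / (pf σ β s t + l)
/-- `Ψ̃_{s,t}(λ) = ∫_{(0,∞)} (1 − e^{−y·Ψ_{s,t}(λ)}) ν(dy)` -/
noncomputable def Psit (σ β : ℝ → ℝ) (ν : Measure ℝ) (s t l : ℝ) : ℝ :=
  ∫ y, (1 - Real.exp (-(y * Psi σ β s t l))) ∂ν

open ProbabilityTheory Topology

/-- Finite measures on `[0,∞)` are determined by their Laplace transform at natural numbers. -/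
lemma ext_of_laplace_nat {μ μ' : Measure ℝ} [IsFiniteMeasure μ] [IsFiniteMeasure μ']
    (hμ : ∀ᵐ x ∂μ, 0 ≤ x) (hμ' : ∀ᵐ x ∂μ', 0 ≤ x)
    (h : ∀ n : ℕ, ∫ x, Real.exp (-(n * x)) ∂μ = ∫ x, Real.exp (-(n * x)) ∂μ') : μ = μ' := by
  have hX : Measurable fun x : ℝ ↦ Real.exp (-x) := by fun_prop
  have key : ∀ (ρ : Measure ℝ) [IsFiniteMeasure ρ], (∀ᵐ x ∂ρ, 0 ≤ x) → ∀ z : ℂ,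
      HasSum (fun n : ℕ ↦ z ^ n / (n.factorial : ℂ) * ((∫ x, Real.exp (-(n * x)) ∂ρ : ℝ) : ℂ))
        (complexMGF (fun x ↦ Real.exp (-x)) ρ z) := by
    intro ρ _ hρ z
    have hInt : ∀ n : ℕ, Integrable (fun x : ℝ ↦ Real.exp (-(n * x))) ρ := fun n ↦ by
      refine Integrable.of_bound (by fun_prop) 1 ?_
      filter_upwards [hρ] with x hx
      rw [Real.norm_eq_abs, Real.abs_exp, Real.exp_le_one_iff]
      have : 0 ≤ (n : ℝ) * x := by positivity
      linarith
    have hle : ∀ n : ℕ, ∫ x, Real.exp (-(n * x)) ∂ρ ≤ ρ.real univ := fun n ↦ by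
      have := integral_mono_ae (hInt n) (integrable_const (1 : ℝ)) (by
        filter_upwards [hρ] with x hx
        rw [Real.exp_le_one_iff]
        have : 0 ≤ (n : ℝ) * x := by positivity
        linarith)
      simpa using this
    have hs := hasSum_integral_of_summable_integral_norm (μ := ρ)
      (F := fun (n : ℕ) (x : ℝ) ↦ z ^ n / (n.factorial : ℂ) * ((Real.exp (-(n * x)) : ℝ) : ℂ))
      (fun n ↦ ((hInt n).ofReal).const_mul _) (by
        refine Summable.of_nonneg_of_le (fun n ↦ integral_nonneg fun x ↦ norm_nonneg _)
          (fun n ↦ ?_) ((Real.summable_pow_div_factorial ‖z‖).mul_right (ρ.real univ))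
        simp only [norm_mul, norm_div, norm_pow, Complex.norm_natCast, Complex.norm_real,
          Real.norm_eq_abs, Real.abs_exp]
        rw [integral_const_mul]
        exact mul_le_mul_of_nonneg_left (hle n) (by positivity))
    have hval : ∀ x : ℝ, ∑' n : ℕ, z ^ n / (n.factorial : ℂ) * ((Real.exp (-(n * x)) : ℝ) : ℂ) =
        Complex.exp (z * (Real.exp (-x) : ℝ)) := by
      intro x
      rw [Complex.exp_eq_exp_ℂ, ← (NormedSpace.expSeries_div_hasSum_exp _).tsum_eq]
      congr 1
      ext n
      have : Real.exp (-(n * x)) = Real.exp (-x) ^ n := by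
        rw [← Real.exp_nat_mul]; ring_nf
      rw [this]
      push_cast
      ring
    simp_rw [hval, integral_const_mul, integral_complex_ofReal] at hs
    exact hs
  have hmap : μ.map (fun x ↦ Real.exp (-x)) = μ'.map (fun x ↦ Real.exp (-x)) := by
    refine Measure.ext_of_complexMGF_eq hX.aemeasurable hX.aemeasurable ?_
    ext z
    have h1 := key μ hμ z
    simp_rw [h] at h1
    exact h1.unique (key μ' hμ' z)
  have hinv : (fun x ↦ -Real.log x) ∘ (fun x : ℝ ↦ Real.exp (-x)) = id := by
    ext x; simp
  have hlog : Measurable fun x : ℝ ↦ -Real.log x := by fun_prop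
  have := congrArg (Measure.map fun x ↦ -Real.log x) hmap
  rwa [Measure.map_map hlog hX, Measure.map_map hlog hX, hinv, Measure.map_id, Measure.map_id]
    at this

/-- A right-continuous real function is Borel measurable. -/
lemma measurable_of_continuousWithinAt_Ici {f : ℝ → ℝ}
    (hf : ∀ x, ContinuousWithinAt f (Ici x) x) : Measurable f := by
  have hceil : ∀ x : ℝ, Tendsto (fun n : ℕ ↦ (⌈x * ((n + 1 : ℕ) : ℝ)⌉ : ℝ) / (n + 1 : ℕ)) atTop
      (𝓝[≥] x) := by
    intro x
    refine tendsto_nhdsWithin_iff.2 ⟨?_, Eventually.of_forall fun n ↦ ?_⟩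
    · refine tendsto_of_tendsto_of_tendsto_of_le_of_le (tendsto_const_nhds (x := x))
        (h := fun n : ℕ ↦ x + 1 / ((n : ℝ) + 1)) ?_ (fun n ↦ ?_) fun n ↦ ?_
      · simpa using tendsto_const_nhds.add (tendsto_one_div_add_atTop_nhds_zero_nat (𝕜 := ℝ))
      · exact (le_div_iff₀ (by positivity)).2 (Int.le_ceil _)
      · have hn : (0 : ℝ) < (n : ℝ) + 1 := by positivity
        simp only [Nat.cast_add, Nat.cast_one]
        rw [div_le_iff₀ hn, add_mul, one_div, inv_mul_cancel₀ hn.ne']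
        exact (Int.ceil_lt_add_one _).le
    · exact mem_Ici.2 ((le_div_iff₀ (by positivity)).2 (Int.le_ceil _))
  refine measurable_of_tendsto_metrizable
    (f := fun (n : ℕ) x ↦ f ((⌈x * ((n + 1 : ℕ) : ℝ)⌉ : ℝ) / (n + 1 : ℕ))) (fun n ↦ ?_)
    (tendsto_pi_nhds.2 fun x ↦ (hf x).tendsto.comp (hceil x))
  have h1 : Measurable fun k : ℤ ↦ f ((k : ℝ) / (n + 1 : ℕ)) := measurable_from_top
  have h2 : Measurable fun x : ℝ ↦ ⌈x * ((n + 1 : ℕ) : ℝ)⌉ := Int.measurable_ceil.comp (by fun_prop)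
  exact h1.comp h2

lemma lintegral_exp_gammaMeasure {a p l : ℝ} (ha : 0 < a) (hp : 0 < p) (hl : 0 ≤ l) :
    ∫⁻ x, ENNReal.ofReal (Real.exp (-(l * x))) ∂gammaMeasure a p =
      ENNReal.ofReal ((p / (p + l)) ^ a) := by
  have hpl : 0 < p + l := by linarith
  have hm : ∀ r, Measurable (gammaPDF a r) := fun r ↦ (measurable_gammaPDFReal a r).ennreal_ofReal
  rw [gammaMeasure, lintegral_withDensity_eq_lintegral_mul _ (hm p) (by fun_prop)]
  have : ∀ x, (gammaPDF a p * fun x ↦ ENNReal.ofReal (Real.exp (-(l * x)))) x =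
      ENNReal.ofReal ((p / (p + l)) ^ a) * gammaPDF a (p + l) x := by
    intro x
    rw [Pi.mul_apply]
    rcases lt_or_ge x 0 with hx | hx
    · rw [gammaPDF_of_neg hx, gammaPDF_of_neg hx, zero_mul, mul_zero]
    · rw [gammaPDF_of_nonneg hx, gammaPDF_of_nonneg hx,
        ← ENNReal.ofReal_mul' (Real.exp_pos _).le, ← ENNReal.ofReal_mul (by positivity)]
      congr 1
      rw [Real.div_rpow hp.le hpl.le, mul_assoc, ← Real.exp_add,
        show -(p * x) + -(l * x) = -((p + l) * x) by ring]
      have := (Real.rpow_pos_of_pos hpl a).ne'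
      field_simp
  simp_rw [this]
  rw [lintegral_const_mul _ (hm _), lintegral_gammaPDF_eq_one ha hpl, mul_one]

lemma lintegral_exp_poissonGammaMix {θ p l : ℝ} (hθ : 0 ≤ θ) (hp : 0 < p) (hl : 0 ≤ l) :
    ∫⁻ x, ENNReal.ofReal (Real.exp (-(l * x))) ∂poissonGammaMix θ p =
      ENNReal.ofReal (Real.exp (-(θ * l / (p + l)))) := by
  have hpl : 0 < p + l := by linarith
  rw [poissonGammaMix, lintegral_add_measure, lintegral_smul_measure, lintegral_sum_measure,
    lintegral_dirac' _ (by fun_prop)]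
  set q := p / (p + l) with hq
  have hq0 : 0 ≤ q := by positivity
  have hterm : ∀ m : ℕ, ∫⁻ x, ENNReal.ofReal (Real.exp (-(l * x)))
      ∂(ENNReal.ofReal (Real.exp (-θ) * θ ^ (m + 1) / (Nat.factorial (m + 1))) •
        gammaMeasure ((m : ℝ) + 1) p) =
      ENNReal.ofReal (Real.exp (-θ) * ((θ * q) ^ (m + 1) / (Nat.factorial (m + 1)))) := by
    intro m
    rw [lintegral_smul_measure, lintegral_exp_gammaMeasure (by positivity) hp hl, smul_eq_mul,
      ← ENNReal.ofReal_mul (by positivity), ← hq]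
    congr 1
    rw [show ((m : ℝ) + 1) = ((m + 1 : ℕ) : ℝ) by push_cast; ring, Real.rpow_natCast, mul_pow]
    ring
  simp_rw [hterm]
  have hsum : HasSum (fun m : ℕ ↦ Real.exp (-θ) * ((θ * q) ^ m / (Nat.factorial m)))
      (Real.exp (-θ) * Real.exp (θ * q)) := by
    rw [Real.exp_eq_exp_ℝ]
    exact (NormedSpace.expSeries_div_hasSum_exp (θ * q)).mul_left _
  have h1 : (-(θ * l / (p + l))) = -θ + θ * q := by
    rw [hq]; field_simp; ring
  rw [h1, Real.exp_add, ← hsum.tsum_eq,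
    ENNReal.ofReal_tsum_of_nonneg (fun n ↦ by positivity) hsum.summable,
    tsum_eq_zero_add' (f := fun m : ℕ ↦
      ENNReal.ofReal (Real.exp (-θ) * ((θ * q) ^ m / (Nat.factorial m)))) ENNReal.summable]
  simp

lemma poissonGammaMix_Iio_zero (θ p : ℝ) : poissonGammaMix θ p (Iio 0) = 0 := by
  simp [poissonGammaMix, Measure.sum_apply, gammaMeasure, withDensity_apply,
    lintegral_gammaPDF_of_nonpos le_rfl]

lemma measurable_poissonGammaMix (p : ℝ) : Measurable fun θ ↦ poissonGammaMix θ p := by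
  refine Measure.measurable_of_measurable_coe _ fun s hs ↦ ?_
  simp only [poissonGammaMix, Measure.add_apply, Measure.smul_apply, Measure.sum_apply _ hs,
    smul_eq_mul]
  fun_prop

lemma continuous_comp_max_zero {f : ℝ → ℝ} (hf : ContinuousOn f (Ici 0)) :
    Continuous fun x ↦ f (max x 0) :=
  hf.comp_continuous (by fun_prop) fun _ ↦ mem_Ici.2 (le_max_right _ _)

/-- On `0 ≤ s ≤ t` the functions `B(0,·)` and `C` are given by globally continuous functions, the
latter as an increment. -/
lemma exists_continuous_Bf_Cf {σ β : ℝ → ℝ} (hσc : ContinuousOn σ (Ici 0))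
    (hβc : ContinuousOn β (Ici 0)) (hσpos : ∀ x ∈ Ici (0 : ℝ), 0 < σ x) :
    ∃ b c : ℝ → ℝ, Continuous b ∧ Continuous c ∧ (∀ s, 0 < b s) ∧
      (∀ s t, s < t → c s < c t) ∧ (∀ s, 0 ≤ s → Bf β 0 s = b s) ∧
      ∀ s t, 0 ≤ s → s ≤ t → Cf σ β s t = c t - c s := by
  have hσ' := continuous_comp_max_zero hσc
  have hβ' := continuous_comp_max_zero hβc
  have hB : Continuous fun v ↦ ∫ u in (0 : ℝ)..v, β (max u 0) :=
    intervalIntegral.continuous_primitive (fun _ _ ↦ hβ'.intervalIntegrable _ _) 0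
  set k : ℝ → ℝ := fun v ↦ σ (max v 0) ^ 2 / 2 * Real.exp (∫ u in (0 : ℝ)..v, β (max u 0)) with hk
  have hkc : Continuous k :=
    ((hσ'.pow 2).div_const 2).mul (Real.continuous_exp.comp hB)
  have hki : ∀ s t, IntervalIntegrable k volume s t := fun s t ↦ hkc.intervalIntegrable s t
  have hkpos : ∀ v, 0 < k v := fun v ↦ by
    have := hσpos (max v 0) (mem_Ici.2 (le_max_right _ _))
    positivity
  have hβeq : ∀ v, 0 ≤ v → ∫ u in (0 : ℝ)..v, β (max u 0) = ∫ u in (0 : ℝ)..v, β u := by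
    intro v hv
    refine intervalIntegral.integral_congr fun u hu ↦ ?_
    rw [uIcc_of_le hv] at hu
    simp [max_eq_left hu.1]
  refine ⟨fun s ↦ Real.exp (-∫ u in (0 : ℝ)..s, β (max u 0)), fun s ↦ ∫ v in (0 : ℝ)..s, k v,
    by fun_prop, intervalIntegral.continuous_primitive hki 0, fun s ↦ Real.exp_pos _,
    fun s t hst ↦ ?_, fun s hs ↦ by simp only [Bf, hβeq s hs], fun s t hs hst ↦ ?_⟩
  · rw [← sub_pos, intervalIntegral.integral_interval_sub_left (hki _ _) (hki _ _)]
    exact intervalIntegral.intervalIntegral_pos_of_pos_on (hki _ _) (fun x _ ↦ hkpos x) hst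
  · simp only [Cf]
    rw [intervalIntegral.integral_interval_sub_left (hki _ _) (hki _ _)]
    refine intervalIntegral.integral_congr fun v hv ↦ ?_
    rw [uIcc_of_le hst] at hv
    have hv0 := hs.trans hv.1
    simp only [hk, hβeq v hv0, max_eq_left hv0]

lemma integrable_one_sub_exp {ν : Measure ℝ} (hνsupp : ν {y : ℝ | ¬ 0 < y} = 0)
    (hνint : (∫⁻ y, ENNReal.ofReal (min (Real.sqrt y) 1) ∂ν) < ⊤) {K : ℝ} (hK : 0 ≤ K) :
    Integrable (fun y ↦ 1 - Real.exp (-(y * K))) ν := by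
  have hpos : ∀ᵐ y ∂ν, 0 < y := hνsupp
  have hi : Integrable (fun y ↦ min (Real.sqrt y) 1) ν := by
    refine ⟨by fun_prop, ?_⟩
    rw [hasFiniteIntegral_iff_ofReal (ae_of_all _ fun y ↦ le_min (Real.sqrt_nonneg _) zero_le_one)]
    exact hνint
  refine (hi.const_mul (K + 1)).mono' (by fun_prop) ?_
  filter_upwards [hpos] with y hy
  have h1 : 0 ≤ y * K := by positivity
  have h2 := Real.one_sub_le_exp_neg (y * K)
  have h3 : Real.exp (-(y * K)) ≤ 1 := Real.exp_le_one_iff.2 (by linarith)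
  rw [Real.norm_eq_abs, abs_of_nonneg (by linarith)]
  rcases le_total y 1 with hy1 | hy1
  · have hs : Real.sqrt y ≤ 1 := Real.sqrt_le_one.2 hy1
    have hs' : y ≤ Real.sqrt y := Real.le_sqrt_of_sq_le (by nlinarith)
    rw [min_eq_left hs]
    nlinarith
  · rw [min_eq_right (Real.one_le_sqrt.2 hy1)]
    linarith [Real.exp_pos (-(y * K))]

lemma measurable_integral_one_sub_exp (ν : Measure ℝ) [SFinite ν] :
    Measurable fun x : ℝ ↦ ∫ y, (1 - Real.exp (-(y * x))) ∂ν := by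
  have h : StronglyMeasurable (Function.uncurry fun x y : ℝ ↦ 1 - Real.exp (-(y * x))) := by
    apply Continuous.stronglyMeasurable
    unfold Function.uncurry
    fun_prop
  exact h.integral_prod_right.measurable

lemma norm_integral_one_sub_exp_le {ν : Measure ℝ} (hνsupp : ν {y : ℝ | ¬ 0 < y} = 0)
    (hνint : (∫⁻ y, ENNReal.ofReal (min (Real.sqrt y) 1) ∂ν) < ⊤) {x K : ℝ} (hx : 0 ≤ x)
    (hxK : x ≤ K) :
    ‖∫ y, (1 - Real.exp (-(y * x))) ∂ν‖ ≤ ∫ y, (1 - Real.exp (-(y * K))) ∂ν := by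
  have hpos : ∀ᵐ y ∂ν, 0 < y := hνsupp
  refine norm_integral_le_of_norm_le (integrable_one_sub_exp hνsupp hνint (hx.trans hxK)) ?_
  filter_upwards [hpos] with y hy
  have h1 : 0 ≤ y * x := by positivity
  have h2 : Real.exp (-(y * x)) ≤ 1 := Real.exp_le_one_iff.2 (by linarith)
  rw [Real.norm_eq_abs, abs_of_nonneg (by linarith)]
  have h3 : Real.exp (-(y * K)) ≤ Real.exp (-(y * x)) := by gcongr
  linarith

section Semigroup

variable {σ β b c : ℝ → ℝ}

lemma pf_pos (hb : ∀ s, 0 < b s) (hc : ∀ s t, s < t → c s < c t)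
    (hB : ∀ s, 0 ≤ s → Bf β 0 s = b s)
    (hC : ∀ s t, 0 ≤ s → s ≤ t → Cf σ β s t = c t - c s) {s t : ℝ} (hs : 0 ≤ s) (hst : s < t) :
    0 < pf σ β s t := by
  rw [pf, hB t (hs.trans hst.le), hC s t hs hst.le]
  have := sub_pos.2 (hc s t hst)
  have := hb t
  positivity

lemma gf_pos (hb : ∀ s, 0 < b s) (hc : ∀ s t, s < t → c s < c t)
    (hB : ∀ s, 0 ≤ s → Bf β 0 s = b s)
    (hC : ∀ s t, 0 ≤ s → s ≤ t → Cf σ β s t = c t - c s) {s t : ℝ} (hs : 0 ≤ s) (hst : s < t) :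
    0 < gf σ β s t := by
  rw [gf, hB s hs, hC s t hs hst.le]
  have := sub_pos.2 (hc s t hst)
  have := hb s
  positivity

lemma Psi_eq (hb : ∀ s, 0 < b s) (hc : ∀ s t, s < t → c s < c t)
    (hB : ∀ s, 0 ≤ s → Bf β 0 s = b s)
    (hC : ∀ s t, 0 ≤ s → s ≤ t → Cf σ β s t = c t - c s) {s t l : ℝ} (hs : 0 ≤ s) (hst : s < t)
    (hl : 0 ≤ l) :
    Psi σ β s t l = l * b t / (b s * (1 + l * b t * (c t - c s))) := by
  have h1 := sub_pos.2 (hc s t hst)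
  have h2 := hb s
  have h3 := hb t
  rw [Psi, pf, gf, hB s hs, hB t (hs.trans hst.le), hC s t hs hst.le]
  field_simp

lemma Psi_nonneg (hb : ∀ s, 0 < b s) (hc : ∀ s t, s < t → c s < c t)
    (hB : ∀ s, 0 ≤ s → Bf β 0 s = b s)
    (hC : ∀ s t, 0 ≤ s → s ≤ t → Cf σ β s t = c t - c s) {s t l : ℝ} (hs : 0 ≤ s) (hst : s < t)
    (hl : 0 ≤ l) : 0 ≤ Psi σ β s t l := by
  have h1 := pf_pos hb hc hB hC hs hst
  have h2 := gf_pos hb hc hB hC hs hst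
  rw [Psi]
  positivity

/-- The flow property `Ψ_{r,s} ∘ Ψ_{s,t} = Ψ_{r,t}`. -/
lemma Psi_Psi (hb : ∀ s, 0 < b s) (hc : ∀ s t, s < t → c s < c t)
    (hB : ∀ s, 0 ≤ s → Bf β 0 s = b s)
    (hC : ∀ s t, 0 ≤ s → s ≤ t → Cf σ β s t = c t - c s) {r s t l : ℝ} (hr : 0 ≤ r) (hrs : r < s)
    (hst : s < t) (hl : 0 ≤ l) :
    Psi σ β r s (Psi σ β s t l) = Psi σ β r t l := by
  have hs := hr.trans hrs.le
  rw [Psi_eq hb hc hB hC hr hrs (Psi_nonneg hb hc hB hC hs hst hl),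
    Psi_eq hb hc hB hC hr (hrs.trans hst) hl, Psi_eq hb hc hB hC hs hst hl]
  have h1 := sub_pos.2 (hc s t hst)
  have h2 := sub_pos.2 (hc r s hrs)
  have h3 := hb r
  have h4 := hb s
  have h5 := hb t
  rw [show c t - c r = (c t - c s) + (c s - c r) by ring]
  generalize c t - c s = x at *
  generalize c s - c r = y at *
  have h6 : 0 < 1 + l * b t * x := by positivity
  have h7 : 0 < 1 + l * b t * (x + y) := by positivity
  have h8 : 0 < 1 + l * b t / (b s * (1 + l * b t * x)) * b s * y := by positivity
  rw [div_eq_div_iff (by positivity) (by positivity)]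
  field_simp
  ring

lemma intervalIntegrable_mul_Psit (hbc : Continuous b) (hcc : Continuous c)
    (hb : ∀ s, 0 < b s) (hc : ∀ s t, s < t → c s < c t)
    (hB : ∀ s, 0 ≤ s → Bf β 0 s = b s)
    (hC : ∀ s t, 0 ≤ s → s ≤ t → Cf σ β s t = c t - c s)
    {ν : Measure ℝ} [SFinite ν] (hνsupp : ν {y : ℝ | ¬ 0 < y} = 0)
    (hνint : (∫⁻ y, ENNReal.ofReal (min (Real.sqrt y) 1) ∂ν) < ⊤)
    {a : ℝ → ℝ} (hann : ∀ x ∈ Ici (0 : ℝ), 0 ≤ a x)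
    (harc : ∀ x ∈ Ici (0 : ℝ), ContinuousWithinAt a (Ici x) x)
    {M : ℝ} (habd : ∀ x ∈ Ici (0 : ℝ), a x ≤ M) {s t l : ℝ} (hs : 0 ≤ s) (hst : s < t)
    (hl : 0 ≤ l) :
    IntervalIntegrable (fun v ↦ a v * Psit σ β ν v t l) volume s t := by
  have ha : Measurable fun x ↦ a (max x 0) := by
    refine measurable_of_continuousWithinAt_Ici fun x ↦ ?_
    refine (harc (max x 0) (mem_Ici.2 (le_max_right _ _))).comp (f := fun x : ℝ ↦ max x 0)
      (by fun_prop) fun y hy ↦ ?_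
    exact mem_Ici.2 (max_le_max_right 0 (mem_Ici.1 hy))
  -- clipping keeps the denominator positive to the right of `t`
  set ψ : ℝ → ℝ := fun v ↦ l * b t / (b v * (1 + l * b t * max (c t - c v) 0)) with hψ
  have hden : ∀ v, 0 < b v * (1 + l * b t * max (c t - c v) 0) := fun v ↦ by
    have := hb v
    have := hb t
    have := le_max_right (c t - c v) 0
    positivity
  have hψc : Continuous ψ := Continuous.div (by fun_prop) (by fun_prop) fun v ↦ (hden v).ne'
  obtain ⟨K, hK⟩ := isCompact_Icc.exists_bound_of_continuousOn (hψc.continuousOn (s := Icc s t))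
  rw [intervalIntegrable_iff_integrableOn_Ioo_of_le hst.le]
  have hcongr : EqOn (fun v ↦ a (max v 0) * ∫ y, (1 - Real.exp (-(y * ψ v))) ∂ν)
      (fun v ↦ a v * Psit σ β ν v t l) (Ioo s t) := by
    intro v hv
    have hv0 : 0 ≤ v := hs.trans hv.1.le
    simp only [Psit, Psi_eq hb hc hB hC hv0 hv.2 hl, max_eq_left hv0, hψ,
      max_eq_left (sub_pos.2 (hc v t hv.2)).le]
  refine IntegrableOn.congr_fun ?_ hcongr measurableSet_Ioo
  refine Measure.integrableOn_of_bounded (by simp)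
    (ha.mul ((measurable_integral_one_sub_exp ν).comp hψc.measurable)).aestronglyMeasurable
    (M := M * ∫ y, (1 - Real.exp (-(y * K))) ∂ν) ?_
  refine (ae_restrict_iff' measurableSet_Ioo).2 (ae_of_all _ fun v hv ↦ ?_)
  have hv0 : 0 ≤ v := hs.trans hv.1.le
  have hψ0 : 0 ≤ ψ v := div_nonneg (mul_nonneg hl (hb t).le) (hden v).le
  rw [norm_mul]
  refine mul_le_mul ?_ ?_ (norm_nonneg _) ((hann 0 self_mem_Ici).trans (habd 0 self_mem_Ici))
  · rw [max_eq_left hv0, Real.norm_eq_abs, abs_of_nonneg (hann v hv0)]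
    exact habd v hv0
  · exact norm_integral_one_sub_exp_le hνsupp hνint hψ0
      ((le_abs_self _).trans (hK v (Ioo_subset_Icc_self hv)))

end Semigroup

lemma lintegral_exp_eq_ofReal_integral {μ : Measure ℝ} [IsFiniteMeasure μ] (hμ : ∀ᵐ x ∂μ, 0 ≤ x)
    {l : ℝ} (hl : 0 ≤ l) :
    ∫⁻ x, ENNReal.ofReal (Real.exp (-(l * x))) ∂μ =
      ENNReal.ofReal (∫ x, Real.exp (-(l * x)) ∂μ) := by
  refine (ofReal_integral_eq_lintegral_ofReal ?_ (ae_of_all _ fun x ↦ (Real.exp_pos _).le)).symm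
  refine Integrable.of_bound (by fun_prop) 1 ?_
  filter_upwards [hμ] with x hx
  rw [Real.norm_eq_abs, Real.abs_exp, Real.exp_le_one_iff]
  have : 0 ≤ l * x := by positivity
  linarith

lemma ae_nonneg_conv {μ ρ : Measure ℝ} [SFinite ρ] (hμ : ∀ᵐ x ∂μ, 0 ≤ x) (hρ : ∀ᵐ x ∂ρ, 0 ≤ x) :
    ∀ᵐ x ∂(Measure.conv μ ρ), 0 ≤ x := by
  have hm : Measurable ((Iio (0 : ℝ)).indicator (1 : ℝ → ENNReal)) :=
    measurable_one.indicator measurableSet_Iio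
  have : Measure.conv μ ρ (Iio 0) = 0 := by
    rw [← lintegral_indicator_one measurableSet_Iio, Measure.lintegral_conv hm]
    refine (lintegral_congr_ae ?_).trans lintegral_zero
    filter_upwards [hμ] with x hx
    refine (lintegral_congr_ae ?_).trans lintegral_zero
    filter_upwards [hρ] with y hy
    have hxy : x + y ∉ Iio (0 : ℝ) := by simpa using add_nonneg hx hy
    exact indicator_of_notMem hxy _
  rw [ae_iff]
  simp only [not_le]
  exact this

/-- Skew convolution property `(Ĩ_{t₁,t₂} H_{t₂,t₃}) ∗ Ĩ_{t₂,t₃} = Ĩ_{t₁,t₃}` for the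
family of laws with Laplace transforms `exp(−∫ ã(v)·Ψ̃_{v,·}(λ) dv)`. -/
theorem stmt_19 (σ β : ℝ → ℝ)
    (hσc : ContinuousOn σ (Set.Ici 0)) (hβc : ContinuousOn β (Set.Ici 0))
    (hσpos : ∀ x ∈ Set.Ici (0:ℝ), 0 < σ x) (hβnn : ∀ x ∈ Set.Ici (0:ℝ), 0 ≤ β x)
    (ν : Measure ℝ) (hσfin : SigmaFinite ν) (hνsupp : ν {y : ℝ | ¬ 0 < y} = 0)
    (hνint : (∫⁻ y, ENNReal.ofReal (min (Real.sqrt y) 1) ∂ν) < ⊤)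
    (a : ℝ → ℝ) (hann : ∀ x ∈ Set.Ici (0:ℝ), 0 ≤ a x)
    (harc : ∀ x ∈ Set.Ici (0:ℝ), ContinuousWithinAt a (Set.Ici x) x)
    (M : ℝ) (habd : ∀ x ∈ Set.Ici (0:ℝ), a x ≤ M)
    (t₁ t₂ t₃ : ℝ) (h₁ : 0 ≤ t₁) (h₁₂ : t₁ < t₂) (h₂₃ : t₂ < t₃)
    (μ₁₂ μ₂₃ μ₁₃ : Measure ℝ)
    (hP₁₂ : IsProbabilityMeasure μ₁₂) (hP₂₃ : IsProbabilityMeasure μ₂₃)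
    (hP₁₃ : IsProbabilityMeasure μ₁₃)
    (h₁₂sup : μ₁₂ (Set.Ici (0:ℝ))ᶜ = 0) (h₂₃sup : μ₂₃ (Set.Ici (0:ℝ))ᶜ = 0)
    (h₁₃sup : μ₁₃ (Set.Ici (0:ℝ))ᶜ = 0)
    (hL₁₂ : ∀ l : ℝ, 0 ≤ l → (∫ x, Real.exp (-(l * x)) ∂μ₁₂) =
      Real.exp (-∫ v in t₁..t₂, a v * Psit σ β ν v t₂ l))
    (hL₂₃ : ∀ l : ℝ, 0 ≤ l → (∫ x, Real.exp (-(l * x)) ∂μ₂₃) =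
      Real.exp (-∫ v in t₂..t₃, a v * Psit σ β ν v t₃ l))
    (hL₁₃ : ∀ l : ℝ, 0 ≤ l → (∫ x, Real.exp (-(l * x)) ∂μ₁₃) =
      Real.exp (-∫ v in t₁..t₃, a v * Psit σ β ν v t₃ l)) :
    Measure.conv (μ₁₂.bind (fun y => Hm σ β t₂ t₃ y)) μ₂₃ = μ₁₃ := by
  have hν1 : SFinite ν := inferInstance
  obtain ⟨b, c, hbc, hcc, hb, hc, hB, hC⟩ := exists_continuous_Bf_Cf hσc hβc hσpos
  have ht₂ : 0 ≤ t₂ := h₁.trans h₁₂.le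
  have hs₁₂ : ∀ᵐ x ∂μ₁₂, 0 ≤ x := h₁₂sup
  have hs₂₃ : ∀ᵐ x ∂μ₂₃, 0 ≤ x := h₂₃sup
  have hs₁₃ : ∀ᵐ x ∂μ₁₃, 0 ≤ x := h₁₃sup
  have hp := pf_pos hb hc hB hC ht₂ h₂₃
  have hg := gf_pos hb hc hB hC ht₂ h₂₃
  have hHm : Measurable fun y ↦ Hm σ β t₂ t₃ y :=
    (measurable_poissonGammaMix _).comp (measurable_id.mul_const _)
  have hbind : ∀ l : ℝ, 0 ≤ l →
      ∫⁻ x, ENNReal.ofReal (Real.exp (-(l * x))) ∂(μ₁₂.bind fun y ↦ Hm σ β t₂ t₃ y) =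
        ENNReal.ofReal (Real.exp (-∫ v in t₁..t₂, a v * Psit σ β ν v t₃ l)) := by
    intro l hl
    have hΨ := Psi_nonneg hb hc hB hC ht₂ h₂₃ hl
    rw [Measure.lintegral_bind hHm.aemeasurable (by fun_prop)]
    have : ∀ᵐ y ∂μ₁₂, ∫⁻ x, ENNReal.ofReal (Real.exp (-(l * x))) ∂(Hm σ β t₂ t₃ y) =
        ENNReal.ofReal (Real.exp (-(Psi σ β t₂ t₃ l * y))) := by
      filter_upwards [hs₁₂] with y hy
      rw [Hm, lintegral_exp_poissonGammaMix (mul_nonneg hy hg.le) hp hl, Psi]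
      congr 3
      ring
    rw [lintegral_congr_ae this, lintegral_exp_eq_ofReal_integral hs₁₂ hΨ, hL₁₂ _ hΨ]
    congr 3
    refine intervalIntegral.integral_congr_ae ?_
    filter_upwards [compl_mem_ae_iff.2 (measure_singleton t₂)] with v hv hvI
    rw [uIoc_of_le h₁₂.le] at hvI
    have hv2 : v < t₂ := lt_of_le_of_ne hvI.2 hv
    simp only [Psit, Psi_Psi hb hc hB hC (h₁.trans hvI.1.le) hv2 h₂₃ hl]
  have hconv : ∀ l : ℝ, 0 ≤ l → ∫⁻ x, ENNReal.ofReal (Real.exp (-(l * x)))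
      ∂(Measure.conv (μ₁₂.bind fun y ↦ Hm σ β t₂ t₃ y) μ₂₃) =
        ENNReal.ofReal (Real.exp (-∫ v in t₁..t₃, a v * Psit σ β ν v t₃ l)) := by
    intro l hl
    have hInt := intervalIntegrable_mul_Psit (l := l) hbc hcc hb hc hB hC hνsupp hνint hann harc
      habd h₁ (h₁₂.trans h₂₃) hl
    rw [Measure.lintegral_conv (by fun_prop)]
    simp_rw [mul_add, neg_add, Real.exp_add, ENNReal.ofReal_mul (Real.exp_pos _).le]
    simp_rw [lintegral_const_mul' _ _ ENNReal.ofReal_ne_top]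
    rw [lintegral_mul_const _ (by fun_prop), hbind l hl, lintegral_exp_eq_ofReal_integral hs₂₃ hl,
      hL₂₃ l hl, ← ENNReal.ofReal_mul (Real.exp_pos _).le, ← Real.exp_add, ← neg_add,
      intervalIntegral.integral_add_adjacent_intervals]
    · exact hInt.mono_set (by
        rw [uIcc_of_le h₁₂.le, uIcc_of_le (h₁₂.trans h₂₃).le]
        exact Icc_subset_Icc_right h₂₃.le)
    · exact hInt.mono_set (by
        rw [uIcc_of_le h₂₃.le, uIcc_of_le (h₁₂.trans h₂₃).le]
        exact Icc_subset_Icc_left h₁₂.le)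
  have hbs : ∀ᵐ x ∂(μ₁₂.bind fun y ↦ Hm σ β t₂ t₃ y), 0 ≤ x := by
    rw [ae_iff]
    simp only [not_le]
    change (μ₁₂.bind fun y ↦ Hm σ β t₂ t₃ y) (Iio 0) = 0
    rw [Measure.bind_apply measurableSet_Iio hHm.aemeasurable]
    simp [Hm, poissonGammaMix_Iio_zero]
  have hcs := ae_nonneg_conv hbs hs₂₃
  have hfin : IsFiniteMeasure (Measure.conv (μ₁₂.bind fun y ↦ Hm σ β t₂ t₃ y) μ₂₃) := by
    refine ⟨?_⟩
    have := hconv 0 le_rfl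
    simp only [zero_mul, neg_zero, Real.exp_zero, ENNReal.ofReal_one, lintegral_one] at this
    rw [this]
    exact ENNReal.ofReal_lt_top
  refine ext_of_laplace_nat hcs hs₁₃ fun n ↦ ?_
  have hn : (0 : ℝ) ≤ n := n.cast_nonneg
  rw [hL₁₃ n hn, ← ENNReal.ofReal_eq_ofReal_iff (integral_nonneg fun x ↦ (Real.exp_pos _).le)
    (Real.exp_pos _).le, ← lintegral_exp_eq_ofReal_integral hcs hn, hconv n hn]
end
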